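/- arXiv:1608.03924 — 4 statements merged into one kernel-verified Lean document; each statement's English description precedes it below -/
import Mathlib

section
/- Let $h$ be a nonzero purely imaginary complex number ($\operatorname{Re} h = 0$), let $M_2$ be a nonzero complex polynomial all of whose zeros $\alpha$ satisfy $\operatorname{Im} h \cdot \operatorname{Im} \alpha \geq 0$, let $\theta \in [0, 2\pi)$, and let $M_1(z) = e^{i\theta} \overline{M_2(\bar z)}$ (the polynomial whose coefficients are the complex conjugates of those of $M_2$, multiplied by $e^{i\theta}$). Then for every real polynomial $p$ having only real zeros, the polynomial $q(z) = M_1(z)\, p(z+h) + M_2(z)\, p(z-h)$ is identically zero or has only real zeros. -/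
open Polynomial in
theorem norm_eval_le_of_roots (M : ℂ[X]) {z w : ℂ}
    (hle : ∀ α, M.eval α = 0 → ‖z - α‖ ≤ ‖w - α‖) : ‖M.eval z‖ ≤ ‖M.eval w‖ := by
  rcases eq_or_ne M 0 with rfl | hM
  · simp
  have key : ∀ x, ‖M.eval x‖ = ‖M.leadingCoeff‖ * (M.roots.map fun α => ‖x - α‖).prod := by
    intro x
    rw [(IsAlgClosed.splits M).eval_eq_prod_roots x, norm_mul]
    exact congrArg _ ((map_multiset_prod (normHom : ℂ →*₀ ℝ) _).trans
      (congrArg _ (Multiset.map_map _ _ _)))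
  rw [key, key]
  refine mul_le_mul_of_nonneg_left ?_ (norm_nonneg _)
  exact Multiset.prod_map_le_prod_map₀ _ _ (fun α _ => norm_nonneg _)
    fun α hα => hle α ((mem_roots hM).1 hα)

open Polynomial in
theorem norm_eval_lt_of_roots (M : ℂ[X]) {z w : ℂ}
    (hle : ∀ α, M.eval α = 0 → ‖z - α‖ ≤ ‖w - α‖) (hw : M.eval w ≠ 0)
    {α : ℂ} (hα : M.eval α = 0) (hlt : ‖z - α‖ < ‖w - α‖) : ‖M.eval z‖ < ‖M.eval w‖ := by
  obtain ⟨N, rfl⟩ := dvd_iff_isRoot.2 hα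
  have hN : ‖N.eval z‖ ≤ ‖N.eval w‖ :=
    norm_eval_le_of_roots N fun β hβ => hle β (by simp [hβ])
  have hNw : N.eval w ≠ 0 := fun h => hw (by simp [h])
  simp only [eval_mul, eval_sub, eval_X, eval_C, norm_mul]
  exact (mul_le_mul_of_nonneg_left hN (norm_nonneg _)).trans_lt
    (mul_lt_mul_of_pos_right hlt (norm_pos_iff.2 hNw))

theorem norm_sub_le_norm_sub_iff_of_re_eq {z w α : ℂ} (h : z.re = w.re) :
    ‖z - α‖ ≤ ‖w - α‖ ↔ (z.im - α.im) ^ 2 ≤ (w.im - α.im) ^ 2 := by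
  rw [← sq_le_sq₀ (norm_nonneg _) (norm_nonneg _), Complex.sq_norm, Complex.sq_norm,
    Complex.normSq_apply, Complex.normSq_apply]
  simp only [Complex.sub_re, Complex.sub_im, h, ← pow_two, add_le_add_iff_left]

theorem norm_sub_lt_norm_sub_iff_of_re_eq {z w α : ℂ} (h : z.re = w.re) :
    ‖z - α‖ < ‖w - α‖ ↔ (z.im - α.im) ^ 2 < (w.im - α.im) ^ 2 := by
  rw [← not_le, norm_sub_le_norm_sub_iff_of_re_eq h.symm, not_le]

open Polynomial in
theorem norm_eval_mul_lt_of_im_mul_pos {h : ℂ} (hre : h.re = 0) {M P : ℂ[X]}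
    (hM : ∀ α, M.eval α = 0 → 0 ≤ h.im * α.im) (hP : ∀ α, P.eval α = 0 → α.im = 0)
    (hnd : (∃ α, P.eval α = 0) ∨ ∃ α, M.eval α = 0 ∧ α.im ≠ 0)
    {z : ℂ} (hz : 0 < h.im * z.im) :
    ‖M.eval z‖ * ‖P.eval (z - h)‖ < ‖M.eval (starRingEnd ℂ z)‖ * ‖P.eval (z + h)‖ := by
  have hMw : M.eval (starRingEnd ℂ z) ≠ 0 := fun h0 => by
    have := hM _ h0
    rw [Complex.conj_im] at this
    linarith
  have hPw : P.eval (z + h) ≠ 0 := fun h0 => by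
    have := hP _ h0
    rw [Complex.add_im] at this
    rw [eq_neg_of_add_eq_zero_left this] at hz
    nlinarith [sq_nonneg h.im]
  have hMle : ∀ α, M.eval α = 0 → ‖z - α‖ ≤ ‖starRingEnd ℂ z - α‖ := fun α hα => by
    rw [norm_sub_le_norm_sub_iff_of_re_eq (by simp), Complex.conj_im]
    have : 0 ≤ z.im * α.im := by
      have hprod := mul_nonneg hz.le (hM α hα)
      rw [mul_mul_mul_comm] at hprod
      exact nonneg_of_mul_nonneg_right hprod (mul_self_pos.2 (left_ne_zero_of_mul hz.ne'))
    nlinarith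
  have hPlt : ∀ α, P.eval α = 0 → ‖z - h - α‖ < ‖z + h - α‖ := fun α hα => by
    rw [norm_sub_lt_norm_sub_iff_of_re_eq (by simp [hre]), hP α hα, Complex.sub_im,
      Complex.add_im]
    nlinarith
  have hM' := norm_eval_le_of_roots M hMle
  have hP' := norm_eval_le_of_roots P fun α hα => (hPlt α hα).le
  rcases hnd with ⟨α, hα⟩ | ⟨α, hα, hαim⟩
  · exact (mul_le_mul_of_nonneg_right hM' (norm_nonneg _)).trans_lt (mul_lt_mul_of_pos_left
      (norm_eval_lt_of_roots P (fun β hβ => (hPlt β hβ).le) hPw hα (hPlt α hα))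
      (norm_pos_iff.2 hMw))
  · refine (mul_le_mul_of_nonneg_left hP' (norm_nonneg _)).trans_lt (mul_lt_mul_of_pos_right
      (norm_eval_lt_of_roots M hMle hMw hα ((hMle α hα).lt_of_ne fun heq => hαim ?_))
      (norm_pos_iff.2 hPw))
    have hge := (norm_sub_le_norm_sub_iff_of_re_eq (α := α) (Complex.conj_re z)).1 heq.ge
    have hle := (norm_sub_le_norm_sub_iff_of_re_eq (α := α) (Complex.conj_re z).symm).1 heq.le
    rw [Complex.conj_im] at hge hle
    have : z.im * α.im = 0 := by nlinarith
    exact (mul_eq_zero.1 this).resolve_left (right_ne_zero_of_mul hz.ne')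

open Polynomial in
theorem exists_map_conj_eq_C_mul (M : ℂ[X]) (hM : ∀ α, M.eval α = 0 → α.im = 0) :
    ∃ k : ℂ, M.map (starRingEnd ℂ) = C k * M := by
  rcases eq_or_ne M 0 with rfl | hM0
  · exact ⟨0, by simp⟩
  have hlc : M.leadingCoeff ≠ 0 := leadingCoeff_ne_zero.2 hM0
  have hs : M = C M.leadingCoeff * (M.roots.map fun α => X - C α).prod :=
    (IsAlgClosed.splits M).eq_prod_roots
  have hprod : ((M.roots.map fun α => X - C α).prod).map (starRingEnd ℂ) =
      (M.roots.map fun α => X - C α).prod := by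
    rw [Polynomial.map_multiset_prod, Multiset.map_map]
    refine congrArg _ (Multiset.map_congr rfl fun α hα => ?_)
    simp [Complex.conj_eq_iff_im.2 (hM α ((mem_roots hM0).1 hα))]
  refine ⟨starRingEnd ℂ M.leadingCoeff / M.leadingCoeff, ?_⟩
  calc M.map (starRingEnd ℂ)
      = C (starRingEnd ℂ M.leadingCoeff) * (M.roots.map fun α => X - C α).prod := by
        conv_lhs => rw [hs]
        rw [Polynomial.map_mul, hprod, map_C]
    _ = C (starRingEnd ℂ M.leadingCoeff / M.leadingCoeff) *
          (C M.leadingCoeff * (M.roots.map fun α => X - C α).prod) := by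
        rw [← mul_assoc, ← C_mul, div_mul_cancel₀ _ hlc]
    _ = _ := by rw [← hs]


/-- Let `h` be nonzero purely imaginary, `M₂ ≠ 0` a complex polynomial all of
whose zeros `α` satisfy `Im h · Im α ≥ 0`, `θ ∈ [0, 2π)`, and
`M₁(z) = e^{iθ} conj(M₂(conj z))`.  Then for every real polynomial `p` with only real zeros,
`q(z) = M₁(z) p(z+h) + M₂(z) p(z-h)` is identically zero or has only real zeros. -/
theorem statement1 (h : ℂ) (hh : h ≠ 0) (hre : h.re = 0)
    (M₂ : Polynomial ℂ) (hM₂ : M₂ ≠ 0)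
    (hzeros : ∀ α : ℂ, M₂.eval α = 0 → 0 ≤ h.im * α.im)
    (θ : ℝ) (hθ : θ ∈ Set.Ico (0 : ℝ) (2 * Real.pi))
    (M₁ : Polynomial ℂ)
    (hM₁ : M₁ = Polynomial.C (Complex.exp (θ * Complex.I)) * M₂.map (starRingEnd ℂ))
    (p : Polynomial ℝ) (hp : ∀ z : ℂ, Polynomial.aeval z p = 0 → z.im = 0) :
    (∀ z : ℂ, M₁.eval z * Polynomial.aeval (z + h) p
        + M₂.eval z * Polynomial.aeval (z - h) p = 0) ∨
      (∀ z : ℂ, M₁.eval z * Polynomial.aeval (z + h) p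
          + M₂.eval z * Polynomial.aeval (z - h) p = 0 → z.im = 0) := by
  have hconj : ∀ z, M₁.eval z =
      Complex.exp (θ * Complex.I) * starRingEnd ℂ (M₂.eval (starRingEnd ℂ z)) := by
    intro z
    rw [hM₁, Polynomial.eval_mul, Polynomial.eval_C, ← Polynomial.eval_map_apply,
      Complex.conj_conj]
  have haeval : ∀ z : ℂ, Polynomial.aeval z p = (p.map (algebraMap ℝ ℂ)).eval z :=
    fun z => (Polynomial.eval_map_algebraMap p z).symm
  simp only [haeval] at hp ⊢
  set P := p.map (algebraMap ℝ ℂ) with hPdef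
  by_cases hnd : (∃ α, P.eval α = 0) ∨ ∃ α, M₂.eval α = 0 ∧ α.im ≠ 0
  · right
    intro z hz
    have hPconj : ∀ w, ‖P.eval (starRingEnd ℂ w)‖ = ‖P.eval w‖ := by
      intro w
      rw [hPdef, Polynomial.eval_map_algebraMap, Polynomial.eval_map_algebraMap,
        Polynomial.aeval_conj, Complex.norm_conj]
    have hh' : starRingEnd ℂ h = -h := by
      apply Complex.ext <;> simp [hre]
    have hnorm : ‖M₂.eval (starRingEnd ℂ z)‖ * ‖P.eval (z + h)‖ =
        ‖M₂.eval z‖ * ‖P.eval (z - h)‖ := by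
      have := congrArg norm (eq_neg_of_add_eq_zero_left hz)
      rwa [hconj, norm_neg, norm_mul, norm_mul, norm_mul, Complex.norm_exp_ofReal_mul_I, one_mul,
        Complex.norm_conj] at this
    have him : h.im ≠ 0 := fun h0 => hh (Complex.ext hre h0)
    by_contra hzim
    rcases (mul_ne_zero him hzim).lt_or_gt with hneg | hpos
    · have := norm_eval_mul_lt_of_im_mul_pos hre hzeros hp hnd (z := starRingEnd ℂ z)
        (by rw [Complex.conj_im]; linarith)
      rw [Complex.conj_conj, ← hPconj (_ - h), ← hPconj (_ + h), map_sub, map_add,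
        Complex.conj_conj, hh', sub_neg_eq_add, ← sub_eq_add_neg] at this
      exact this.ne hnorm
    · exact (norm_eval_mul_lt_of_im_mul_pos hre hzeros hp hnd hpos).ne' hnorm
  · push Not at hnd
    obtain ⟨hProot, hMroot⟩ := hnd
    obtain ⟨k, hk⟩ := exists_map_conj_eq_C_mul M₂ hMroot
    obtain ⟨c, hc⟩ : ∃ c, P = Polynomial.C c := by
      refine ⟨_, Polynomial.eq_C_of_degree_eq_zero ?_⟩
      by_contra hdeg
      obtain ⟨α, hα⟩ := IsAlgClosed.exists_root P hdeg
      exact hProot α hα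
    have hq : ∀ z, M₁.eval z * P.eval (z + h) + M₂.eval z * P.eval (z - h) =
        (Complex.exp (θ * Complex.I) * k + 1) * c * M₂.eval z := by
      intro z
      rw [hM₁, hk, hc]
      simp only [Polynomial.eval_mul, Polynomial.eval_C]
      ring
    simp only [hq]
    by_cases h0 : (Complex.exp (θ * Complex.I) * k + 1) * c = 0
    · left
      simp [h0]
    · right
      intro z hz
      exact hMroot z ((mul_eq_zero.1 hz).resolve_left h0)
end

section
/- Let $M_1, M_2 : \mathbb{C} \to \mathbb{C}$ be functions, neither identically zero, and let $h \in \mathbb{C} \setminus \{0\}$. Suppose that for every $f$ in the Laguerre–Pólya class $\mathcal{L}\text{-}\mathcal{P}$, the function $z \mapsto M_1(z) f(z+h) + M_2(z) f(z-h)$ belongs to $\mathcal{L}\text{-}\mathcal{P}$ or is identically zero. Then $M_1$ and $M_2$ are entire functions (analytic on all of $\mathbb{C}$) and either $h \in \mathbb{R}$ or $ih \in \mathbb{R}$ (equivalently, $h^2 \in \mathbb{R}$). -/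
/-- The Laguerre–Pólya class: entire functions of the form
`f(z) = c zⁿ e^{-a z² + b z} ∏ₖ (1 - z/xₖ) e^{z/xₖ}` with `c, b, xₖ ∈ ℝ`, `c ≠ 0`,
`xₖ ≠ 0`, `a ≥ 0` and `∑ₖ xₖ⁻² < ∞`.  The family of zeros is indexed by `ℕ`; the value
`x k = 0` encodes an absent factor (then `(1 - z·(x k)⁻¹)·e^{z·(x k)⁻¹} = 1` since
`(0:ℝ)⁻¹ = 0`), so finite and empty families are allowed. -/
def LaguerrePolya (f : ℂ → ℂ) : Prop :=
  ∃ (c b a : ℝ) (n : ℕ) (x : ℕ → ℝ),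
    c ≠ 0 ∧ 0 ≤ a ∧ Summable (fun k => ((x k)⁻¹) ^ 2) ∧
    ∀ z : ℂ, f z =
      (c : ℂ) * z ^ n * Complex.exp (-(a : ℂ) * z ^ 2 + (b : ℂ) * z) *
        ∏' k : ℕ, ((1 - z * ((x k : ℂ))⁻¹) * Complex.exp (z * ((x k : ℂ))⁻¹))

open scoped ComplexConjugate

lemma LaguerrePolya.pow (n : ℕ) : LaguerrePolya (fun z => z ^ n) :=
  ⟨1, 0, 0, n, 0, one_ne_zero, le_rfl, by simp, fun z => by simp⟩

lemma norm_one_sub_mul_exp_sub_one_le (w : ℂ) :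
    ‖(1 - w) * Complex.exp w - 1‖ ≤ ‖w‖ ^ 2 * (1 + (1 + ‖w‖) * Real.exp ‖w‖) := by
  have hr : ‖Complex.exp w - (1 + w)‖ ≤ ‖w‖ ^ 2 * Real.exp ‖w‖ := by
    simpa [Finset.sum_range_succ] using Complex.norm_exp_sub_sum_le_norm_mul_exp w 2
  have h1 : ‖1 - w‖ ≤ 1 + ‖w‖ := by simpa using norm_sub_le (1 : ℂ) w
  calc ‖(1 - w) * Complex.exp w - 1‖
      = ‖-(w ^ 2) + (1 - w) * (Complex.exp w - (1 + w))‖ := by congr 1; ring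
    _ ≤ ‖w‖ ^ 2 + ‖1 - w‖ * ‖Complex.exp w - (1 + w)‖ := by
        refine (norm_add_le _ _).trans_eq ?_
        rw [norm_neg, norm_pow, norm_mul]
    _ ≤ ‖w‖ ^ 2 + (1 + ‖w‖) * (‖w‖ ^ 2 * Real.exp ‖w‖) := by gcongr
    _ = _ := by ring

/-- The canonical product of genus one attached to reciprocals of zeros `y k` with
`∑ (y k)² < ∞` is entire. -/
lemma differentiable_tprod_one_sub_mul_exp {y : ℕ → ℝ} (hy : Summable fun k => y k ^ 2) :
    Differentiable ℂ fun z : ℂ => ∏' k, ((1 - z * (y k : ℂ)) * Complex.exp (z * (y k : ℂ))) := by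
  intro z₀
  obtain ⟨R, hR⟩ : ∃ R, ‖z₀‖ < R := exists_gt _
  have hR0 : 0 ≤ R := (norm_nonneg _).trans hR.le
  obtain ⟨Y, hY⟩ : ∃ Y, ∀ k, |y k| ≤ Y :=
    ⟨√(∑' k, y k ^ 2), fun k => Real.abs_le_sqrt (hy.le_tsum k fun _ _ => sq_nonneg _)⟩
  set C : ℝ := R ^ 2 * (1 + (1 + R * Y) * Real.exp (R * Y))
  have hbound : ∀ k, ∀ z ∈ Metric.ball (0 : ℂ) R,
      ‖(1 - z * (y k : ℂ)) * Complex.exp (z * (y k : ℂ)) - 1‖ ≤ C * y k ^ 2 := by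
    intro k z hz
    have hz : ‖z‖ ≤ R := (mem_ball_zero_iff.mp hz).le
    have hw : ‖z * (y k : ℂ)‖ ≤ R * |y k| := by
      rw [norm_mul, Complex.norm_real, Real.norm_eq_abs]
      gcongr
    have hw' : ‖z * (y k : ℂ)‖ ≤ R * Y := hw.trans (by gcongr; exact hY k)
    have hY0 : 0 ≤ R * Y := (norm_nonneg _).trans hw'
    calc _ ≤ _ := norm_one_sub_mul_exp_sub_one_le _
      _ ≤ (R * |y k|) ^ 2 * (1 + (1 + R * Y) * Real.exp (R * Y)) := by gcongr
      _ = C * y k ^ 2 := by rw [mul_pow, sq_abs]; ring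
  have key := (hy.mul_left C).hasProdLocallyUniformlyOn_nat_one_add
    (f := fun k z => (1 - z * (y k : ℂ)) * Complex.exp (z * (y k : ℂ)) - 1)
    Metric.isOpen_ball (Filter.Eventually.of_forall hbound) (fun k => by fun_prop)
  simp only [add_sub_cancel] at key
  refine (TendstoLocallyUniformlyOn.differentiableOn key (Filter.Eventually.of_forall fun s => ?_)
    Metric.isOpen_ball).differentiableAt
    (Metric.isOpen_ball.mem_nhds (mem_ball_zero_iff.mpr hR))
  fun_prop

lemma LaguerrePolya.differentiable {f : ℂ → ℂ} (hf : LaguerrePolya f) : Differentiable ℂ f := by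
  obtain ⟨c, b, a, n, x, -, -, hx, hf⟩ := hf
  have hp := differentiable_tprod_one_sub_mul_exp hx
  rw [funext hf]
  push_cast at hp
  fun_prop

lemma LaguerrePolya.apply_conj {f : ℂ → ℂ} (hf : LaguerrePolya f) (z : ℂ) :
    f (conj z) = conj (f z) := by
  obtain ⟨c, b, a, n, x, -, -, -, hf⟩ := hf
  rw [hf, hf]
  have hp := Function.LeftInverse.map_tprod (L := .unconditional ℕ)
    (fun k : ℕ => (1 - z * ((x k : ℂ))⁻¹) * Complex.exp (z * ((x k : ℂ))⁻¹))
    (g := starRingEnd ℂ) (g' := starRingEnd ℂ) Complex.continuous_conj Complex.continuous_conj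
    Complex.conj_conj
  simp only [map_mul, hp]
  simp [← Complex.exp_conj]

/-- if `M₁, M₂ : ℂ → ℂ` are not identically zero, `h ≠ 0`, and the operator
`f ↦ M₁(z) f(z+h) + M₂(z) f(z-h)` sends `𝓛-𝓟` into `𝓛-𝓟 ∪ {0}`, then `M₁, M₂` are entire
and `h ∈ ℝ` or `ih ∈ ℝ`. -/
theorem statement3 (M₁ M₂ : ℂ → ℂ) (hM₁ : ¬ ∀ z, M₁ z = 0) (hM₂ : ¬ ∀ z, M₂ z = 0)
    (h : ℂ) (hh : h ≠ 0)
    (H : ∀ f : ℂ → ℂ, LaguerrePolya f →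
      LaguerrePolya (fun z => M₁ z * f (z + h) + M₂ z * f (z - h)) ∨
        ∀ z : ℂ, M₁ z * f (z + h) + M₂ z * f (z - h) = 0) :
    Differentiable ℂ M₁ ∧ Differentiable ℂ M₂ ∧ (h.im = 0 ∨ h.re = 0) := by
  have hdiff (n : ℕ) : Differentiable ℂ fun z => M₁ z * (z + h) ^ n + M₂ z * (z - h) ^ n := by
    rcases H _ (LaguerrePolya.pow n) with hL | h0
    · exact hL.differentiable
    · simp [h0]
  have hconj (n : ℕ) (z : ℂ) :
      M₁ (conj z) * (conj z + h) ^ n + M₂ (conj z) * (conj z - h) ^ n =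
        conj (M₁ z * (z + h) ^ n + M₂ z * (z - h) ^ n) := by
    rcases H _ (LaguerrePolya.pow n) with hL | h0
    · exact hL.apply_conj z
    · rw [h0, h0, map_zero]
  have hd0 := hdiff 0
  have hd1 := hdiff 1
  simp only [pow_zero, mul_one, pow_one] at hd0 hd1
  refine ⟨?_, ?_, ?_⟩
  · have hM : M₁ = fun z => ((M₁ z + M₂ z) +
        ((M₁ z * (z + h) + M₂ z * (z - h)) - z * (M₁ z + M₂ z)) / h) / 2 := by
      funext z; field_simp; ring
    rw [hM]
    fun_prop
  · have hM : M₂ = fun z => ((M₁ z + M₂ z) -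
        ((M₁ z * (z + h) + M₂ z * (z - h)) - z * (M₁ z + M₂ z)) / h) / 2 := by
      funext z; field_simp; ring
    rw [hM]
    fun_prop
  · obtain ⟨z, hz⟩ := not_forall.mp hM₁
    have e0 := hconj 0 z
    have e1 := hconj 1 z
    have e2 := hconj 2 z
    have e3 := hconj 3 z
    simp only [map_add, map_sub, map_mul, map_pow, pow_zero, pow_one, mul_one] at e0 e1 e2 e3
    have hA : (h ^ 2 - conj h ^ 2) * conj (M₁ z + M₂ z) = 0 := by
      rw [map_add]
      linear_combination e2 - 2 * conj z * e1 + (conj z ^ 2 - h ^ 2) * e0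
    have hE : (h ^ 2 - conj h ^ 2) * conj (h * (M₁ z - M₂ z)) = 0 := by
      rw [map_add] at hA
      rw [map_mul, map_sub]
      linear_combination e3 - (3 * conj z ^ 2 + h ^ 2) * e1
        + (2 * conj z ^ 3 - 2 * conj z * h ^ 2) * e0 - 3 * conj z * hA
    have hsq : h ^ 2 = conj h ^ 2 := by
      by_contra hne
      have hne := sub_ne_zero.mpr hne
      have a0 := (mul_eq_zero.mp hA).resolve_left hne
      have b0 := (mul_eq_zero.mp hE).resolve_left hne
      rw [map_eq_zero] at a0 b0
      have b1 := (mul_eq_zero.mp b0).resolve_left hh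
      exact hz (by linear_combination (a0 + b1) / 2)
    have him := congrArg Complex.im hsq
    simp [pow_two] at him
    have : h.im * h.re = 0 := by linarith
    exact mul_eq_zero.mp this
end

section
/- (Hermite–Biehler, as used in the paper.) Let $P$ be a nonconstant complex polynomial all of whose zeros lie in the open upper half-plane $\{z \in \mathbb{C} : \operatorname{Im} z > 0\}$, and write $P(z) = \sum_k (c_k + i d_k) z^k$ with $c_k, d_k \in \mathbb{R}$. Then the real polynomial $Q(z) = \sum_k c_k z^k$ is identically zero or has only real zeros (every $z \in \mathbb{C}$ with $Q(z) = 0$ satisfies $\operatorname{Im} z = 0$). -/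
open Polynomial ComplexConjugate in
/-- The polynomial of real parts of coefficients, evaluated at `z`, is half of
`P z + conj (P (conj z))`. -/
theorem two_mul_aeval_of_coeff_eq_re {P : ℂ[X]} {Q : ℝ[X]}
    (hQ : ∀ k : ℕ, Q.coeff k = (P.coeff k).re) (z : ℂ) :
    2 * aeval z Q = P.eval z + conj (P.eval (conj z)) := by
  have hpoly : C 2 * Q.map (algebraMap ℝ ℂ) = P + P.map (starRingEnd ℂ) := by
    ext k
    simp [hQ, Complex.add_conj]
  have hconj : (P.map (starRingEnd ℂ)).eval z = conj (P.eval (conj z)) := by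
    have h := eval_map_apply (p := P) (starRingEnd ℂ) (conj z)
    rwa [Complex.conj_conj] at h
  rw [← hconj, ← eval_add, ← hpoly, eval_mul, eval_C, eval_map_algebraMap]

open ComplexConjugate in
/-- A point of the open upper half-plane is closer than its conjugate to any other point of the
open upper half-plane. -/
theorem norm_sub_lt_norm_conj_sub {z r : ℂ} (hz : 0 < z.im) (hr : 0 < r.im) :
    ‖z - r‖ < ‖conj z - r‖ := by
  rw [Complex.norm_def, Complex.norm_def]
  apply Real.sqrt_lt_sqrt (Complex.normSq_nonneg _)
  simp only [Complex.normSq_apply, Complex.sub_re, Complex.sub_im, Complex.conj_re,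
    Complex.conj_im]
  nlinarith [mul_pos hz hr]

open ComplexConjugate in
theorem norm_prod_sub_lt_norm_prod_conj_sub {z : ℂ} (hz : 0 < z.im) {s : Multiset ℂ}
    (hs : ∀ r ∈ s, 0 < r.im) (hne : s ≠ 0) :
    ‖(s.map (z - ·)).prod‖ < ‖(s.map (conj z - ·)).prod‖ := by
  induction s using Multiset.induction with
  | empty => exact absurd rfl hne
  | cons a s ih =>
    have ha := norm_sub_lt_norm_conj_sub hz (hs a (Multiset.mem_cons_self a s))
    by_cases h : s = 0
    · simpa [h] using ha
    · have ih' := ih (fun r hr => hs r (Multiset.mem_cons_of_mem hr)) h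
      simp only [Multiset.map_cons, Multiset.prod_cons, norm_mul]
      exact mul_lt_mul'' ha ih' (norm_nonneg _) (norm_nonneg _)

open Polynomial ComplexConjugate in
/-- If all zeros of a nonconstant `P` lie in the open upper half-plane, then `‖P z‖` is smaller
than `‖P (conj z)‖` for `z` in the open upper half-plane. -/
theorem norm_eval_lt_norm_eval_conj {P : ℂ[X]} (hP : P.natDegree ≠ 0)
    (hzeros : ∀ z : ℂ, P.eval z = 0 → 0 < z.im) {z : ℂ} (hz : 0 < z.im) :
    ‖P.eval z‖ < ‖P.eval (conj z)‖ := by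
  have hsplits : P.Splits := IsAlgClosed.splits P
  have hP0 : P ≠ 0 := by
    rintro rfl
    exact hP natDegree_zero
  have hroots : P.roots ≠ 0 := by
    intro h
    apply hP
    rw [hsplits.natDegree_eq_card_roots, h, Multiset.card_zero]
  rw [hsplits.eval_eq_prod_roots, hsplits.eval_eq_prod_roots, norm_mul, norm_mul]
  exact mul_lt_mul_of_pos_left
    (norm_prod_sub_lt_norm_prod_conj_sub hz (fun r hr => hzeros r (isRoot_of_mem_roots hr)) hroots)
    (norm_pos_iff.mpr (leadingCoeff_ne_zero.mpr hP0))

/-- Hermite–Biehler: if `P` is a nonconstant complex polynomial with all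
zeros in the open upper half-plane and `Q` is the real polynomial whose coefficients are
the real parts of the coefficients of `P`, then `Q` is identically zero or has only real
zeros. -/
theorem statement14 (P : Polynomial ℂ) (hP : P.natDegree ≠ 0)
    (hzeros : ∀ z : ℂ, P.eval z = 0 → 0 < z.im)
    (Q : Polynomial ℝ) (hQ : ∀ k : ℕ, Q.coeff k = (P.coeff k).re) :
    Q = 0 ∨ ∀ z : ℂ, Polynomial.aeval z Q = 0 → z.im = 0 := by
  right
  intro z hz
  have hsum := two_mul_aeval_of_coeff_eq_re hQ z
  rw [hz, mul_zero] at hsum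
  have hnorm : ‖P.eval z‖ = ‖P.eval (starRingEnd ℂ z)‖ := by
    rw [eq_neg_of_add_eq_zero_left hsum.symm, norm_neg, Complex.norm_conj]
  rcases lt_trichotomy z.im 0 with h | h | h
  · have hlt := norm_eval_lt_norm_eval_conj hP hzeros (z := starRingEnd ℂ z) (by simpa using h)
    rw [Complex.conj_conj] at hlt
    exact absurd hnorm hlt.ne'
  · exact h
  · exact absurd hnorm (norm_eval_lt_norm_eval_conj hP hzeros h).ne
end

section
/- (Pólya.) Let $f$ be a function in the Laguerre–Pólya class $\mathcal{L}\text{-}\mathcal{P}$ and let $c \in \mathbb{R}$. Then the function $z \mapsto f(z + ic) + f(z - ic)$ belongs to $\mathcal{L}\text{-}\mathcal{P}$ or is identically zero. -/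
open Complex Filter Topology

/-- The Weierstrass elementary factor of genus one. -/
noncomputable def weierstrassOne (u : ℂ) : ℂ := (1 - u) * exp u

/-- The Weierstrass elementary factor of genus two. -/
noncomputable def weierstrassTwo (u : ℂ) : ℂ := (1 - u) * exp (u + u ^ 2 / 2)

lemma weierstrassOne_eq (u : ℂ) : weierstrassOne u = exp (-u ^ 2 / 2) * weierstrassTwo u := by
  rw [weierstrassOne, weierstrassTwo, mul_left_comm, ← exp_add]
  ring_nf

lemma weierstrassOne_zero : weierstrassOne 0 = 1 := by simp [weierstrassOne]

lemma continuous_weierstrassTwo : Continuous weierstrassTwo := by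
  unfold weierstrassTwo; fun_prop

lemma norm_weierstrassOne_sub_one_le (u : ℂ) :
    ‖weierstrassOne u - 1‖ ≤ ‖u‖ ^ 2 * Real.exp ‖u‖ := by
  have hd : ∀ x : ℂ, HasDerivAt weierstrassOne (-x * exp x) x := fun x ↦ by
    have := ((hasDerivAt_id x).const_sub 1).mul (hasDerivAt_exp x)
    convert! this using 1
    simp; ring
  have key := Convex.norm_image_sub_le_of_norm_hasDerivWithin_le (f := weierstrassOne)
    (s := Metric.closedBall (0 : ℂ) ‖u‖) (x := 0) (y := u) (C := ‖u‖ * Real.exp ‖u‖)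
    (fun x _ ↦ (hd x).hasDerivWithinAt) (fun x hx ↦ ?_) (convex_closedBall _ _) (by simp) (by simp)
  · rw [weierstrassOne_zero, sub_zero] at key
    linarith
  · rw [mem_closedBall_zero_iff] at hx
    rw [norm_mul, norm_neg]
    gcongr
    exact (norm_exp_le_exp_norm x).trans (Real.exp_le_exp.2 hx)

lemma norm_weierstrassTwo_sub_one_le (u : ℂ) :
    ‖weierstrassTwo u - 1‖ ≤ ‖u‖ ^ 3 * Real.exp (‖u‖ + ‖u‖ ^ 2 / 2) := by
  have hd : ∀ x : ℂ, HasDerivAt weierstrassTwo (-x ^ 2 * exp (x + x ^ 2 / 2)) x := fun x ↦ by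
    have := ((hasDerivAt_id x).const_sub 1).mul
      ((((hasDerivAt_id x).add (((hasDerivAt_id x).pow 2).div_const 2))).cexp)
    convert! this using 1
    simp; ring
  have key := Convex.norm_image_sub_le_of_norm_hasDerivWithin_le (f := weierstrassTwo)
    (s := Metric.closedBall (0 : ℂ) ‖u‖) (x := 0) (y := u)
    (C := ‖u‖ ^ 2 * Real.exp (‖u‖ + ‖u‖ ^ 2 / 2))
    (fun x _ ↦ (hd x).hasDerivWithinAt) (fun x hx ↦ ?_) (convex_closedBall _ _) (by simp) (by simp)
  · have h0 : weierstrassTwo 0 = 1 := by simp [weierstrassTwo]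
    rw [h0, sub_zero] at key
    linarith
  · rw [mem_closedBall_zero_iff] at hx
    rw [norm_mul, norm_neg, norm_pow]
    gcongr
    refine (norm_exp_le_exp_norm _).trans (Real.exp_le_exp.2 ((norm_add_le _ _).trans ?_))
    rw [norm_div, norm_pow]
    norm_num
    gcongr

/-- A uniform bound on the terms of a square-summable real sequence. -/
lemma exists_abs_le_of_summable_sq {w : ℕ → ℝ} (hw : Summable fun k ↦ w k ^ 2) :
    ∃ B, 0 ≤ B ∧ ∀ k, |w k| ≤ B :=
  ⟨√(∑' k, w k ^ 2), Real.sqrt_nonneg _, fun k ↦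
    Real.abs_le_sqrt (hw.le_tsum k fun _ _ ↦ sq_nonneg _)⟩

lemma norm_mul_ofReal (z : ℂ) (r : ℝ) : ‖z * (r : ℂ)‖ = ‖z‖ * |r| := by
  rw [norm_mul, norm_real, Real.norm_eq_abs]

/-- Locally uniform control of the genus one factors by a summable sequence. -/
lemma exists_summable_bound_weierstrassOne {w : ℕ → ℝ} (hw : Summable fun k ↦ w k ^ 2) (R : ℝ) :
    ∃ u : ℕ → ℝ, Summable u ∧ ∀ k (z : ℂ), ‖z‖ ≤ R → ‖weierstrassOne (z * w k) - 1‖ ≤ u k := by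
  obtain ⟨B, hB0, hB⟩ := exists_abs_le_of_summable_sq hw
  refine ⟨fun k ↦ R ^ 2 * Real.exp (R * B) * w k ^ 2, hw.mul_left _, fun k z hz ↦ ?_⟩
  refine (norm_weierstrassOne_sub_one_le _).trans ?_
  have hR : 0 ≤ R := (norm_nonneg z).trans hz
  rw [norm_mul_ofReal, mul_pow, sq_abs]
  calc ‖z‖ ^ 2 * w k ^ 2 * Real.exp (‖z‖ * |w k|) ≤ R ^ 2 * w k ^ 2 * Real.exp (R * B) := by
        gcongr
        exact hB k
    _ = _ := by ring

lemma summable_norm_weierstrassOne {w : ℕ → ℝ} (hw : Summable fun k ↦ w k ^ 2) (z : ℂ) :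
    Summable fun k ↦ ‖weierstrassOne (z * w k) - 1‖ := by
  obtain ⟨u, hu, h⟩ := exists_summable_bound_weierstrassOne hw ‖z‖
  exact hu.of_nonneg_of_le (fun _ ↦ norm_nonneg _) fun k ↦ h k z le_rfl

lemma multipliable_weierstrassOne {w : ℕ → ℝ} (hw : Summable fun k ↦ w k ^ 2) (z : ℂ) :
    Multipliable fun k ↦ weierstrassOne (z * w k) := by
  simpa using multipliable_one_add_of_summable (summable_norm_weierstrassOne hw z)

lemma summable_norm_weierstrassTwo {w : ℕ → ℝ} (hw : Summable fun k ↦ w k ^ 2) (z : ℂ) :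
    Summable fun k ↦ ‖weierstrassTwo (z * w k) - 1‖ := by
  obtain ⟨B, hB0, hB⟩ := exists_abs_le_of_summable_sq hw
  refine (hw.mul_left (‖z‖ ^ 3 * B * Real.exp (‖z‖ * B + (‖z‖ * B) ^ 2 / 2))).of_nonneg_of_le
    (fun _ ↦ norm_nonneg _) fun k ↦ (norm_weierstrassTwo_sub_one_le _).trans ?_
  rw [norm_mul_ofReal]
  calc (‖z‖ * |w k|) ^ 3 * Real.exp (‖z‖ * |w k| + (‖z‖ * |w k|) ^ 2 / 2)
      = ‖z‖ ^ 3 * |w k| * |w k| ^ 2 * Real.exp (‖z‖ * |w k| + (‖z‖ * |w k|) ^ 2 / 2) := by ring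
    _ ≤ ‖z‖ ^ 3 * B * |w k| ^ 2 * Real.exp (‖z‖ * B + (‖z‖ * B) ^ 2 / 2) := by
        gcongr <;> exact hB k
    _ = _ := by rw [sq_abs]; ring

lemma multipliable_weierstrassTwo {w : ℕ → ℝ} (hw : Summable fun k ↦ w k ^ 2) (z : ℂ) :
    Multipliable fun k ↦ weierstrassTwo (z * w k) := by
  simpa using multipliable_one_add_of_summable (summable_norm_weierstrassTwo hw z)

lemma tprod_weierstrassOne_eq {w : ℕ → ℝ} (hw : Summable fun k ↦ w k ^ 2) (z : ℂ) :
    ∏' k, weierstrassOne (z * w k) =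
      exp (-z ^ 2 / 2 * (∑' k, w k ^ 2 : ℝ)) * ∏' k, weierstrassTwo (z * w k) := by
  have h1 : HasSum (fun k ↦ -z ^ 2 / 2 * ((w k ^ 2 : ℝ) : ℂ)) (-z ^ 2 / 2 * (∑' k, w k ^ 2 : ℝ)) :=
    (hasSum_ofReal.2 hw.hasSum).mul_left _
  rw [← (h1.cexp.mul (multipliable_weierstrassTwo hw z).hasProd).tprod_eq]
  refine tprod_congr fun k ↦ ?_
  rw [weierstrassOne_eq]
  congr 2
  push_cast
  ring

lemma tprod_weierstrassTwo_ne_zero {w : ℕ → ℝ} (hw : Summable fun k ↦ w k ^ 2) {z : ℂ}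
    (hz : ∀ k, z * w k ≠ 1) : ∏' k, weierstrassTwo (z * w k) ≠ 0 := by
  have := tprod_one_add_ne_zero_of_summable (f := fun k ↦ weierstrassTwo (z * w k) - 1)
    (fun k ↦ ?_) (summable_norm_weierstrassTwo hw z)
  · simpa using this
  · rw [add_sub_cancel]
    exact mul_ne_zero (sub_ne_zero.2 (hz k).symm) (exp_ne_zero _)

/-- On the imaginary axis the canonical product controls the sum of squares. -/
lemma one_add_tsum_sq_le {w : ℕ → ℝ} (hw : Summable fun k ↦ w k ^ 2) :
    1 + ∑' k, w k ^ 2 ≤ ‖∏' k, weierstrassOne (I * w k)‖ ^ 2 := by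
  have h1 := ((multipliable_weierstrassOne hw I).hasProd.tendsto_prod_nat.norm).pow 2
  refine le_of_tendsto_of_tendsto' (hw.hasSum.tendsto_sum_nat.const_add 1) h1 fun n ↦ ?_
  rw [norm_prod, ← Finset.prod_pow]
  have h2 : ∀ k, ‖weierstrassOne (I * w k)‖ ^ 2 = 1 + w k ^ 2 := fun k ↦ by
    rw [weierstrassOne, norm_mul, mul_comm I, norm_exp_ofReal_mul_I, mul_one, ← normSq_eq_norm_sq,
      normSq_apply]
    simp
    ring
  simp_rw [h2]
  induction n with
  | zero => simp
  | succ n ih =>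
    rw [Finset.sum_range_succ, Finset.prod_range_succ]
    have : (0 : ℝ) ≤ ∑ k ∈ Finset.range n, w k ^ 2 := Finset.sum_nonneg fun _ _ ↦ sq_nonneg _
    nlinarith [mul_le_mul_of_nonneg_right ih (by positivity : 0 ≤ 1 + w n ^ 2),
      mul_nonneg this (sq_nonneg (w n))]

lemma abs_le_of_antitone_of_tsum_le {w : ℕ → ℝ} (hw : Summable fun k ↦ w k ^ 2)
    (ha : Antitone fun k ↦ |w k|) {M : ℝ} (hM : ∑' k, w k ^ 2 ≤ M) (k : ℕ) :
    |w k| ≤ √(M / (k + 1)) := by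
  apply Real.abs_le_sqrt
  rw [le_div_iff₀ (by positivity)]
  refine le_trans ?_ ((hw.sum_le_tsum (Finset.range (k + 1)) fun _ _ ↦ sq_nonneg _).trans hM)
  have := Finset.card_nsmul_le_sum (Finset.range (k + 1)) (fun j ↦ w j ^ 2) (w k ^ 2) fun j hj ↦
    sq_le_sq.2 (ha (Nat.lt_succ_iff.1 (Finset.mem_range.1 hj)))
  simp at this
  linarith

/-- Functions of Laguerre–Pólya form, normalised to take the value `1` at the origin, are closed
under pointwise limits. -/
lemma exists_canonical_form_of_tendsto {b : ℕ → ℝ} {w : ℕ → ℕ → ℝ} {G : ℂ → ℂ}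
    (hw : ∀ N, Summable fun k ↦ w N k ^ 2) (ha : ∀ N, Antitone fun k ↦ |w N k|)
    (hG : ∀ z, Tendsto (fun N ↦ exp (b N * z) * ∏' k, weierstrassOne (z * w N k)) atTop
      (𝓝 (G z))) :
    ∃ (a β : ℝ) (v : ℕ → ℝ), 0 ≤ a ∧ Summable (fun k ↦ v k ^ 2) ∧
      ∀ z, G z = exp (-a * z ^ 2 + β * z) * ∏' k, weierstrassOne (z * v k) := by
  -- the sums of squares are bounded
  obtain ⟨M, hM⟩ : ∃ M, ∀ N, ∑' k, w N k ^ 2 ≤ M := by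
    obtain ⟨K, hK⟩ := (((hG I).norm).pow 2).bddAbove_range
    refine ⟨K, fun N ↦ ?_⟩
    have h1 := hK ⟨N, rfl⟩
    have h2 := one_add_tsum_sq_le (hw N)
    simp only [norm_mul, norm_exp_ofReal_mul_I, one_mul] at h1
    linarith
  have hwB : ∀ N k, |w N k| ≤ √(M / (k + 1)) := fun N ↦
    abs_le_of_antitone_of_tsum_le (hw N) (ha N) (hM N)
  have hM0 : 0 ≤ M := (tsum_nonneg fun _ ↦ sq_nonneg _).trans (hM 0)
  -- extract a convergent subsequence
  obtain ⟨⟨v, S⟩, -, φ, hφ, hlim⟩ := IsCompact.tendsto_subseq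
    (x := fun N ↦ (w N, ∑' k, w N k ^ 2))
    ((isCompact_univ_pi fun k : ℕ ↦ isCompact_Icc (a := -√(M / (k + 1))) (b := √(M / (k + 1)))).prod
      (isCompact_Icc (a := 0) (b := M)))
    (fun N ↦ ⟨fun k _ ↦ abs_le.1 (hwB N k), tsum_nonneg fun _ ↦ sq_nonneg _, hM N⟩)
  have hS : Tendsto (fun N ↦ ∑' k, w (φ N) k ^ 2) atTop (𝓝 S) :=
    (continuous_snd.tendsto _).comp hlim
  have hv : ∀ k, Tendsto (fun N ↦ w (φ N) k) atTop (𝓝 (v k)) :=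
    tendsto_pi_nhds.1 ((continuous_fst.tendsto _).comp hlim)
  have hsum : ∀ m, ∑ k ∈ Finset.range m, v k ^ 2 ≤ S := fun m ↦
    le_of_tendsto_of_tendsto' (tendsto_finsetSum _ fun k _ ↦ (hv k).pow 2) hS fun N ↦
      (hw (φ N)).sum_le_tsum _ fun _ _ ↦ sq_nonneg _
  have hvs : Summable fun k ↦ v k ^ 2 :=
    summable_of_sum_range_le (fun _ ↦ sq_nonneg _) hsum
  have hvS : ∑' k, v k ^ 2 ≤ S := hvs.tsum_le_of_sum_range_le hsum
  -- convergence of the genus two products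
  have hprod : ∀ z : ℂ, Tendsto (fun N ↦ ∏' k, weierstrassTwo (z * w (φ N) k)) atTop
      (𝓝 (∏' k, weierstrassTwo (z * v k))) := fun z ↦ by
    have hbd : Summable fun k : ℕ ↦ (‖z‖ * √(M / (k + 1))) ^ 3 *
        Real.exp (‖z‖ * √M + (‖z‖ * √M) ^ 2 / 2) := by
      apply Summable.mul_right
      have : (fun k : ℕ ↦ (‖z‖ * √(M / (k + 1))) ^ 3) =
          fun k : ℕ ↦ (‖z‖ * √M) ^ 3 * (1 / ((k + 1 : ℕ) : ℝ) ^ (3 / 2 : ℝ)) := by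
        ext k
        rw [Real.sqrt_div hM0, mul_div_assoc', div_pow, div_eq_mul_one_div]
        congr 2
        rw [Real.sqrt_eq_rpow, ← Real.rpow_natCast, ← Real.rpow_mul (by positivity)]
        norm_num
      rw [this]
      exact ((summable_nat_add_iff 1).2
        (Real.summable_one_div_nat_rpow.2 (by norm_num : (1 : ℝ) < 3 / 2))).mul_left _
    have := tendsto_tprod_one_add_of_dominated_convergence (𝓕 := atTop)
      (f := fun N k ↦ weierstrassTwo (z * w (φ N) k) - 1)
      (g := fun k ↦ weierstrassTwo (z * v k) - 1) hbd (fun k ↦ ?_) (.of_forall fun N k ↦ ?_)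
    · simpa using this
    · exact ((continuous_weierstrassTwo.tendsto _).comp
        (((continuous_ofReal.tendsto _).comp (hv k)).const_mul z)).sub_const 1
    · refine (norm_weierstrassTwo_sub_one_le _).trans ?_
      rw [norm_mul_ofReal]
      have h1 := hwB (φ N) k
      have h2 : √(M / (k + 1)) ≤ √M :=
        Real.sqrt_le_sqrt (div_le_self hM0 (by linarith [k.cast_nonneg (α := ℝ)]))
      have h3 := h1.trans h2
      gcongr
  set H : ℂ → ℂ := fun z ↦ exp (-z ^ 2 / 2 * S) * ∏' k, weierstrassTwo (z * v k) with hH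
  have hHlim : ∀ z, Tendsto (fun N ↦ ∏' k, weierstrassOne (z * w (φ N) k)) atTop (𝓝 (H z)) := by
    intro z
    simp_rw [fun N ↦ tprod_weierstrassOne_eq (hw (φ N)) z]
    refine Tendsto.mul ?_ (hprod z)
    exact (continuous_exp.tendsto _).comp
      (((continuous_ofReal.tendsto _).comp hS).const_mul (-z ^ 2 / 2))
  -- the linear exponents converge
  obtain ⟨β, hβ⟩ : ∃ β, Tendsto (fun N ↦ b (φ N)) atTop (𝓝 β) := by
    obtain ⟨B, hB0, hB⟩ := exists_abs_le_of_summable_sq hvs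
    set τ : ℝ := (1 + B)⁻¹
    have hτ : 0 < τ := by positivity
    have hlt : ∀ k, |τ * v k| < 1 := fun k ↦ by
      rw [abs_mul, abs_of_pos hτ, inv_mul_lt_one₀ (by positivity)]
      linarith [hB k]
    have hne : H τ ≠ 0 ∧ H (-τ : ℝ) ≠ 0 := by
      refine ⟨mul_ne_zero (exp_ne_zero _) (tprod_weierstrassTwo_ne_zero hvs fun k h ↦ ?_),
        mul_ne_zero (exp_ne_zero _) (tprod_weierstrassTwo_ne_zero hvs fun k h ↦ ?_)⟩ <;>
      · norm_cast at h
        have := abs_lt.1 (hlt k)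
        linarith
    have hexp : ∀ s : ℝ, H s ≠ 0 →
        Tendsto (fun N ↦ exp (b (φ N) * s)) atTop (𝓝 (G s / H s)) := fun s hs ↦ by
      refine (((hG s).comp hφ.tendsto_atTop).div (hHlim s) hs).congr' ?_
      filter_upwards [(hHlim s).eventually_ne hs] with N hN
      simp [hN]
    have h1 := hexp τ hne.1
    have h2 := hexp (-τ : ℝ) hne.2
    have h3 : G τ / H τ ≠ 0 := fun h0 ↦ by
      have := (h1.mul h2).congr fun N ↦ (by
        rw [← exp_add]; push_cast; ring_nf; exact exp_zero : _ = (1 : ℂ))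
      have := tendsto_nhds_unique this tendsto_const_nhds
      simp [h0] at this
    refine ⟨Real.log ‖G τ / H τ‖ / τ, ?_⟩
    refine (((h1.norm).log (norm_ne_zero_iff.2 h3)).div_const τ).congr fun N ↦ ?_
    rw [← ofReal_mul, norm_exp_ofReal, Real.log_exp, mul_div_cancel_right₀ _ hτ.ne']
  refine ⟨(S - ∑' k, v k ^ 2) / 2, β, v, by linarith, hvs, fun z ↦ ?_⟩
  have h1 : Tendsto (fun N ↦ exp (b (φ N) * z) * ∏' k, weierstrassOne (z * w (φ N) k)) atTop
      (𝓝 (exp (β * z) * H z)) :=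
    ((continuous_exp.tendsto _).comp
      (((continuous_ofReal.tendsto _).comp hβ).mul_const z)).mul (hHlim z)
  rw [tendsto_nhds_unique ((hG z).comp hφ.tendsto_atTop) h1, hH, tprod_weierstrassOne_eq hvs z]
  simp only
  rw [← mul_assoc, ← mul_assoc, ← exp_add, ← exp_add]
  congr 2
  push_cast
  ring

/-- The elements of a finite multiset of reals, padded by zeros, arranged in order of decreasing
absolute value. -/
lemma exists_antitone_enumeration (s : Multiset ℝ) :
    ∃ (w : ℕ → ℝ) (n : ℕ), Antitone (fun k ↦ |w k|) ∧ (∀ k, n ≤ k → w k = 0) ∧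
      ∀ g : ℝ → ℂ, (s.map g).prod = ∏ k ∈ Finset.range n, g (w k) := by
  let r : ℝ → ℝ → Prop := fun a b ↦ |b| ≤ |a|
  have : Std.Total r := ⟨fun a b ↦ le_total _ _⟩
  have : IsTrans ℝ r := ⟨fun a b c h1 h2 ↦ le_trans h2 h1⟩
  have : DecidableRel r := Classical.decRel r
  set l := s.toList.insertionSort r with hl
  have hp : l.Pairwise r := List.pairwise_insertionSort r _
  have hs : (l : Multiset ℝ) = s := by
    rw [← s.coe_toList]
    exact Multiset.coe_eq_coe.2 (List.perm_insertionSort r _)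
  refine ⟨fun k ↦ l.getD k 0, l.length, fun i j hij ↦ ?_, fun k hk ↦ ?_, fun g ↦ ?_⟩
  · rcases lt_or_ge j l.length with hj | hj
    · rcases hij.eq_or_lt with rfl | hlt
      · exact le_rfl
      · simp only [List.getD_eq_getElem _ _ hj, List.getD_eq_getElem _ _ (hlt.trans hj)]
        exact List.pairwise_iff_getElem.1 hp i j (hlt.trans hj) hj hlt
    · simp only [List.getD_eq_default _ _ hj, abs_zero]
      exact abs_nonneg _
  · exact List.getD_eq_default _ _ hk
  · rw [← hs, Multiset.map_coe, Multiset.prod_coe, Finset.prod_range, ← List.prod_ofFn]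
    congr 1
    apply List.ext_getElem <;> simp

lemma multiset_prod_exp (s : Multiset ℝ) (z : ℂ) :
    (s.map fun r : ℝ ↦ exp (-(z * r))).prod = exp (-(s.sum : ℝ) * z) := by
  induction s using Multiset.induction with
  | empty => simp
  | cons a s ih =>
    rw [Multiset.map_cons, Multiset.prod_cons, ih, Multiset.sum_cons, ← exp_add]
    congr 1
    push_cast
    ring

/-- A polynomial with real zeros, expanded around a real point which is not a zero. -/
lemma exists_canonical_form_of_multiset (s : Multiset ℝ) {t : ℝ} (ht : t ∉ s) :
    ∃ (b : ℝ) (w : ℕ → ℝ), (Summable fun k ↦ w k ^ 2) ∧ (Antitone fun k ↦ |w k|) ∧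
      ∀ z : ℂ, (s.map fun r : ℝ ↦ t + z - (r : ℂ)).prod =
        (s.map fun r : ℝ ↦ (t : ℂ) - r).prod *
          (exp (b * z) * ∏' k, weierstrassOne (z * w k)) := by
  obtain ⟨w, n, hw, h0, hg⟩ := exists_antitone_enumeration (s.map fun r ↦ (r - t)⁻¹)
  refine ⟨-(s.map fun r ↦ (r - t)⁻¹).sum, w, summable_of_ne_finset_zero (s := Finset.range n)
    fun k hk ↦ ?_, hw, fun z ↦ ?_⟩
  · rw [h0 k (by simpa using hk)]
    simp
  · rw [tprod_eq_prod (s := Finset.range n) fun k hk ↦ by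
      rw [h0 k (by simpa using hk)]; simp [weierstrassOne_zero],
      ← hg fun x ↦ weierstrassOne (z * x)]
    push_cast
    rw [← multiset_prod_exp, Multiset.map_map, Multiset.map_map, ← Multiset.prod_map_mul,
      ← Multiset.prod_map_mul]
    congr 1
    refine Multiset.map_congr rfl fun r hr ↦ ?_
    have hne : (r : ℂ) - t ≠ 0 := by
      rw [sub_ne_zero, Ne, ofReal_inj]
      rintro rfl
      exact ht hr
    simp only [Function.comp, weierstrassOne, ofReal_inv, ofReal_sub]
    rw [mul_left_comm (exp _), ← exp_add, neg_add_cancel, exp_zero, mul_one]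
    field_simp
    ring

/-- A pointwise limit of products of exponentials and real-rooted polynomials has a canonical form
around each real point where it does not vanish. -/
lemma exists_canonical_form_at_of_tendsto {b : ℕ → ℝ} {C : ℕ → ℂ} {s : ℕ → Multiset ℝ} {F : ℂ → ℂ}
    (hF : ∀ z, Tendsto (fun N ↦ C N * exp (b N * z) * ((s N).map fun r : ℝ ↦ z - r).prod) atTop
      (𝓝 (F z))) {t : ℝ} (ht : F t ≠ 0) :
    ∃ (a β : ℝ) (v : ℕ → ℝ), 0 ≤ a ∧ Summable (fun k ↦ v k ^ 2) ∧
      ∀ z, F (t + z) = F t * (exp (-a * z ^ 2 + β * z) * ∏' k, weierstrassOne (z * v k)) := by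
  obtain ⟨N₀, hN₀⟩ := eventually_atTop.1 ((hF t).eventually_ne ht)
  have hmem : ∀ N, t ∉ s (N + N₀) := fun N hmem ↦ hN₀ (N + N₀) (by omega) <| by
    rw [Multiset.prod_eq_zero (Multiset.mem_map.2 ⟨t, hmem, sub_self (t : ℂ)⟩), mul_zero]
  choose β w hw ha hz using fun N ↦ exists_canonical_form_of_multiset (s (N + N₀)) (hmem N)
  obtain ⟨a, β', v, h0, hv, h⟩ := exists_canonical_form_of_tendsto (b := fun N ↦ b (N + N₀) + β N)
    (w := w) (G := fun z ↦ F (t + z) / F t) hw ha fun z ↦ by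
      refine (((hF (t + z)).comp (tendsto_add_atTop_nat N₀)).div
        ((hF t).comp (tendsto_add_atTop_nat N₀)) ht).congr fun N ↦ ?_
      have hne := hN₀ (N + N₀) (by omega)
      simp only [Function.comp_apply, Pi.div_apply] at hne ⊢
      rw [hz, div_eq_iff hne]
      push_cast
      rw [mul_add, add_mul, exp_add, exp_add]
      ring
  exact ⟨a, β', v, h0, hv, fun z ↦ by rw [← h z, mul_div_cancel₀ _ ht]⟩

lemma laguerrePolya_of_canonical_form {F : ℂ → ℂ} {K b a : ℝ} (n : ℕ) {u : ℕ → ℝ} (hK : K ≠ 0)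
    (ha : 0 ≤ a) (hu : Summable fun k ↦ u k ^ 2)
    (hF : ∀ z, F z = K * z ^ n * exp (-a * z ^ 2 + b * z) * ∏' k, weierstrassOne (z * u k)) :
    LaguerrePolya F :=
  ⟨K, b, a, n, fun k ↦ (u k)⁻¹, hK, ha, by simpa using hu, fun z ↦ by
    simp [hF, weierstrassOne]⟩

/-- A genus one factor centred at `t`, rewritten with a genus one factor centred at the origin. -/
lemma weierstrassOne_sub_mul (z : ℂ) (t v : ℝ) :
    weierstrassOne ((z - t) * v) =
      ((if 1 + t * v = 0 then -v * Real.exp (-t * v) else (1 + t * v) * Real.exp (-t * v) : ℝ) :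
        ℂ) * (if 1 + t * v = 0 then z else 1) *
        exp (z * (if 1 + t * v = 0 then v else t * v ^ 2 / (1 + t * v) : ℝ)) *
        weierstrassOne (z * (v / (1 + t * v) : ℝ)) := by
  split_ifs with h
  · have h' : (1 : ℂ) + t * v = 0 := by exact_mod_cast h
    have e1 : (z - t) * (v : ℂ) = -t * v + z * v := by ring
    have e2 : 1 - (z - t) * (v : ℂ) = -v * z := by linear_combination h'
    rw [h, div_zero, ofReal_zero, mul_zero, weierstrassOne_zero, weierstrassOne, mul_one, e2, e1,
      exp_add]
    push_cast
    ring
  · have h' : (1 : ℂ) + t * v ≠ 0 := by exact_mod_cast h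
    have e1 : (z - t) * (v : ℂ) =
        -t * v + z * (t * v ^ 2 / (1 + t * v)) + z * (v / (1 + t * v)) := by
      field_simp
      ring
    have e2 : 1 - (z - t) * (v : ℂ) = (1 + t * v) * (1 - z * (v / (1 + t * v))) := by
      field_simp
      ring
    rw [weierstrassOne, weierstrassOne, e2, e1, exp_add, exp_add]
    push_cast
    ring

/-- A function with a canonical form around a real point is in the Laguerre–Pólya class. -/
lemma laguerrePolya_of_canonical_form_at {F : ℂ → ℂ} {K t a β : ℝ} {v : ℕ → ℝ} (ha : 0 ≤ a)
    (hv : Summable fun k ↦ v k ^ 2) (h0 : ∃ z, F z ≠ 0)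
    (hF : ∀ z, F (t + z) = K * (exp (-a * z ^ 2 + β * z) * ∏' k, weierstrassOne (z * v k))) :
    LaguerrePolya F := by
  have hsmall : ∀ᶠ k in cofinite, 1 / 2 ≤ 1 + t * v k := by
    have h1 : Tendsto (fun k ↦ 1 + t * v k) cofinite (𝓝 1) := by
      have h2 := hv.tendsto_cofinite_zero
      have h3 : Tendsto v cofinite (𝓝 0) := by
        rw [tendsto_zero_iff_abs_tendsto_zero]
        simpa [Function.comp_def, Real.sqrt_sq_eq_abs] using h2.sqrt
      simpa using (h3.const_mul t).const_add 1
    exact (h1.eventually_const_lt (by norm_num : (1 / 2 : ℝ) < 1)).mono fun _ ↦ le_of_lt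
  have hne : ∀ᶠ k in cofinite, 1 + t * v k ≠ 0 := hsmall.mono fun k hk ↦ by linarith
  have hfin : {k | 1 + t * v k = 0}.Finite := by simpa [eventually_cofinite] using hne
  set A : ℕ → ℝ := fun k ↦ if 1 + t * v k = 0 then -v k * Real.exp (-t * v k)
    else (1 + t * v k) * Real.exp (-t * v k)
  set B : ℕ → ℝ := fun k ↦ if 1 + t * v k = 0 then v k else t * v k ^ 2 / (1 + t * v k)
  set u : ℕ → ℝ := fun k ↦ v k / (1 + t * v k)
  have hA : Multipliable A := by
    have h1 : Summable fun k ↦ ‖A k - 1‖ := by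
      refine (summable_norm_weierstrassOne hv (-t : ℝ)).congr_cofinite ?_
      filter_upwards [hne] with k hk
      simp only [A, if_neg hk]
      rw [← norm_real]
      simp [weierstrassOne]
    simpa using multipliable_one_add_of_summable h1
  have hB : Summable B := by
    refine Summable.of_norm_bounded_eventually (hv.mul_left (2 * |t|)) ?_
    filter_upwards [hne, hsmall] with k hk hk'
    simp only [B, if_neg hk]
    rw [norm_div, norm_mul, Real.norm_eq_abs, Real.norm_eq_abs, Real.norm_eq_abs,
      abs_of_nonneg (sq_nonneg (v k)), abs_of_pos (by linarith : 0 < 1 + t * v k),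
      div_le_iff₀ (by linarith)]
    have : 0 ≤ |t| * v k ^ 2 := by positivity
    nlinarith
  have hu : Summable fun k ↦ u k ^ 2 := by
    refine Summable.of_norm_bounded_eventually (hv.mul_left 4) ?_
    filter_upwards [hsmall] with k hk
    simp only [u]
    rw [Real.norm_of_nonneg (sq_nonneg _), div_pow, div_le_iff₀ (by positivity)]
    nlinarith [mul_nonneg (sq_nonneg (v k)) (by nlinarith : 0 ≤ 4 * (1 + t * v k) ^ 2 - 1)]
  have hprod : ∀ z : ℂ, ∏' k, weierstrassOne ((z - t) * v k) =
      (∏' k, A k : ℝ) * z ^ hfin.toFinset.card * exp (z * (∑' k, B k : ℝ)) *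
        ∏' k, weierstrassOne (z * u k) := fun z ↦ by
    have h1 : HasProd (fun k ↦ (A k : ℂ)) (∏' k, A k : ℝ) :=
      hA.hasProd.map ofRealHom continuous_ofReal
    have h2 : HasProd (fun k ↦ if 1 + t * v k = 0 then z else 1) (z ^ hfin.toFinset.card) := by
      have := hasProd_prod_of_ne_finset_one (f := fun k ↦ if 1 + t * v k = 0 then z else 1)
        (s := hfin.toFinset) (L := .unconditional ℕ) fun k hk ↦ if_neg (by simpa using hk)
      rwa [Finset.prod_congr rfl (g := fun _ ↦ z) fun k hk ↦ if_pos (by simpa using hk),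
        Finset.prod_const] at this
    have h3 : HasProd (fun k ↦ exp (z * B k)) (exp (z * (∑' k, B k : ℝ))) :=
      ((hasSum_ofReal.2 hB.hasSum).mul_left z).cexp
    rw [← (((h1.mul h2).mul h3).mul (multipliable_weierstrassOne hu z).hasProd).tprod_eq]
    exact tprod_congr fun k ↦ weierstrassOne_sub_mul z t (v k)
  have hform : ∀ z, F z = ((K * Real.exp (-a * t ^ 2 - β * t) * ∏' k, A k : ℝ) : ℂ) *
      z ^ hfin.toFinset.card * exp (-a * z ^ 2 + (2 * a * t + β + ∑' k, B k : ℝ) * z) *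
        ∏' k, weierstrassOne (z * u k) := fun z ↦ by
    have e : exp (-a * (z - t) ^ 2 + β * (z - t)) * exp (z * (∑' k, B k : ℝ)) =
        exp (-a * t ^ 2 - β * t) * exp (-a * z ^ 2 + (2 * a * t + β + ∑' k, B k : ℝ) * z) := by
      rw [← exp_add, ← exp_add]
      congr 1
      push_cast
      ring
    rw [← add_sub_cancel (t : ℂ) z, hF, hprod, add_sub_cancel]
    simp only [ofReal_mul, ofReal_exp, ofReal_sub, ofReal_neg, ofReal_pow]
    linear_combination (K : ℂ) * ((∏' k, A k : ℝ) : ℂ) * z ^ hfin.toFinset.card *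
      (∏' k, weierstrassOne (z * u k)) * e
  refine laguerrePolya_of_canonical_form _ (fun h ↦ ?_) ha hu hform
  obtain ⟨z, hz⟩ := h0
  exact hz (by rw [hform, h]; simp)

/-- Polynomial functions with real coefficients and only real zeros, and the zero function. -/
def IsRealRooted (g : ℂ → ℂ) : Prop :=
  ∃ (C : ℝ) (s : Multiset ℝ), ∀ z, g z = C * (s.map fun r : ℝ ↦ z - (r : ℂ)).prod

lemma IsRealRooted.mul {g h : ℂ → ℂ} (hg : IsRealRooted g) (hh : IsRealRooted h) :
    IsRealRooted fun z ↦ g z * h z := by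
  obtain ⟨C, s, hs⟩ := hg
  obtain ⟨D, t, ht⟩ := hh
  refine ⟨C * D, s + t, fun z ↦ ?_⟩
  beta_reduce
  rw [hs, ht, Multiset.map_add, Multiset.prod_add]
  push_cast
  ring

lemma isRealRooted_const (C : ℝ) : IsRealRooted fun _ ↦ C := ⟨C, 0, by simp⟩

lemma isRealRooted_id : IsRealRooted fun z ↦ z := ⟨1, {0}, by simp⟩

lemma IsRealRooted.pow {g : ℂ → ℂ} (hg : IsRealRooted g) (n : ℕ) :
    IsRealRooted fun z ↦ g z ^ n := by
  induction n with
  | zero => simpa using isRealRooted_const 1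
  | succ n ih => simpa only [pow_succ] using ih.mul hg

lemma IsRealRooted.prod {g : ℕ → ℂ → ℂ} (hg : ∀ k, IsRealRooted (g k)) (n : ℕ) :
    IsRealRooted fun z ↦ ∏ k ∈ Finset.range n, g k z := by
  induction n with
  | zero => simpa using isRealRooted_const 1
  | succ n ih => simpa only [Finset.prod_range_succ] using ih.mul (hg n)

lemma isRealRooted_one_sub_mul (w : ℝ) : IsRealRooted fun z ↦ 1 - z * w := by
  rcases eq_or_ne w 0 with rfl | hw
  · simpa using isRealRooted_const 1
  · refine ⟨-w, {w⁻¹}, fun z ↦ ?_⟩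
    have : (w : ℂ) ≠ 0 := ofReal_ne_zero.2 hw
    simp only [Multiset.map_singleton, Multiset.prod_singleton]
    push_cast
    field_simp
    ring

lemma isRealRooted_one_sub_sq {a : ℝ} (ha : 0 ≤ a) : IsRealRooted fun z ↦ 1 - a * z ^ 2 := by
  have h := (isRealRooted_one_sub_mul (√a)).mul (isRealRooted_one_sub_mul (-√a))
  have e : (a : ℂ) = (√a : ℂ) ^ 2 := by rw [← ofReal_pow, Real.sq_sqrt ha]
  convert! h using 2 with z
  rw [e]
  push_cast
  ring

section Canonical

variable {f : ℂ → ℂ} {K b a : ℝ} {n : ℕ} {w : ℕ → ℝ}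

/-- Laguerre–Pólya functions are pointwise limits of products of exponentials and real-rooted
polynomials. -/
lemma exists_tendsto_of_canonical_form (ha : 0 ≤ a) (hw : Summable fun k ↦ w k ^ 2)
    (hf : ∀ z, f z = K * z ^ n * exp (-a * z ^ 2 + b * z) * ∏' k, weierstrassOne (z * w k)) :
    ∃ (β : ℕ → ℝ) (g : ℕ → ℂ → ℂ), (∀ N, IsRealRooted (g N)) ∧
      ∀ z, Tendsto (fun N ↦ exp (β N * z) * g N z) atTop (𝓝 (f z)) := by
  refine ⟨fun N ↦ b + ∑ k ∈ Finset.range N, w k, fun N z ↦ K * z ^ n *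
    (1 - (a / N : ℝ) * z ^ 2) ^ N * ∏ k ∈ Finset.range N, (1 - z * w k), fun N ↦ ?_, fun z ↦ ?_⟩
  · exact (((isRealRooted_const K).mul (isRealRooted_id.pow n)).mul
      ((isRealRooted_one_sub_sq (by positivity)).pow N)).mul
      (IsRealRooted.prod (fun k ↦ isRealRooted_one_sub_mul (w k)) N)
  · rw [hf, exp_add]
    have h1 := tendsto_one_add_div_pow_exp (-a * z ^ 2)
    have h2 := (multipliable_weierstrassOne hw z).hasProd.tendsto_prod_nat
    refine (((h1.mul_const (exp (b * z))).const_mul (K * z ^ n)).mul h2).congr fun N ↦ ?_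
    simp only [weierstrassOne]
    rw [Finset.prod_mul_distrib, ← exp_sum, ← Finset.mul_sum]
    push_cast
    rw [add_mul, exp_add, mul_comm z (∑ k ∈ Finset.range N, (w k : ℂ))]
    ring_nf

lemma differentiable_of_canonical_form (hw : Summable fun k ↦ w k ^ 2)
    (hf : ∀ z, f z = K * z ^ n * exp (-a * z ^ 2 + b * z) * ∏' k, weierstrassOne (z * w k)) :
    Differentiable ℂ f := by
  have hd : Differentiable ℂ weierstrassOne := by unfold weierstrassOne; fun_prop
  have hp : Differentiable ℂ fun z : ℂ ↦ ∏' k, weierstrassOne (z * w k) := fun z₀ ↦ by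
    obtain ⟨u, hu, h⟩ := exists_summable_bound_weierstrassOne hw (‖z₀‖ + 1)
    have h1 := Summable.hasProdLocallyUniformlyOn_nat_one_add
      (f := fun k (z : ℂ) ↦ weierstrassOne (z * w k) - 1)
      (Metric.isOpen_ball (x := (0 : ℂ)) (ε := ‖z₀‖ + 1)) hu
      (.of_forall fun k z hz ↦ h k z (mem_ball_zero_iff.1 hz).le)
      fun k ↦ ((hd.comp (differentiable_id.mul_const _)).sub_const 1).continuous.continuousOn
    simp only [add_sub_cancel] at h1
    refine ((hasProdLocallyUniformlyOn_iff_tendstoLocallyUniformlyOn.1 h1).differentiableOn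
      (.of_forall fun s ↦ ?_) Metric.isOpen_ball).differentiableAt
      (Metric.isOpen_ball.mem_nhds (by simp))
    exact (Differentiable.fun_finsetProd fun k _ ↦
      hd.comp (differentiable_id.mul_const _)).differentiableOn
  rw [funext hf]
  fun_prop

lemma conj_of_canonical_form (hw : Summable fun k ↦ w k ^ 2)
    (hf : ∀ z, f z = K * z ^ n * exp (-a * z ^ 2 + b * z) * ∏' k, weierstrassOne (z * w k))
    (z : ℂ) : f (starRingEnd ℂ z) = starRingEnd ℂ (f z) := by
  have h1 := ((multipliable_weierstrassOne hw z).hasProd.map (starRingEnd ℂ)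
    continuous_conj).tprod_eq
  rw [hf, hf, map_mul, ← h1]
  simp [weierstrassOne, ← exp_conj]

end Canonical

lemma norm_sub_lt_norm_add {z : ℂ} {c : ℝ} (h : 0 < c * z.im) (r : ℝ) :
    ‖z - I * c - r‖ < ‖z + I * c - r‖ := by
  rw [← sq_lt_sq₀ (norm_nonneg _) (norm_nonneg _), ← normSq_eq_norm_sq, ← normSq_eq_norm_sq,
    normSq_apply, normSq_apply]
  simp
  nlinarith

lemma norm_multiset_prod_sub_lt {z : ℂ} {c : ℝ} (h : 0 < c * z.im) {s : Multiset ℝ} (hs : s ≠ 0) :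
    ‖(s.map fun r : ℝ ↦ z - I * c - (r : ℂ)).prod‖ <
      ‖(s.map fun r : ℝ ↦ z + I * c - (r : ℂ)).prod‖ := by
  have key : s = 0 ∨ ‖(s.map fun r : ℝ ↦ z - I * c - (r : ℂ)).prod‖ <
      ‖(s.map fun r : ℝ ↦ z + I * c - (r : ℂ)).prod‖ := by
    clear hs
    induction s using Multiset.induction with
    | empty => exact .inl rfl
    | cons r s ih =>
      right
      simp only [Multiset.map_cons, Multiset.prod_cons, norm_mul]
      have h1 := norm_sub_lt_norm_add h r
      rcases ih with rfl | ih
      · simpa using h1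
      · exact mul_lt_mul'' h1 ih (norm_nonneg _) (norm_nonneg _)
  exact key.resolve_left hs

/-- The zeros of a weighted sum of two opposite imaginary shifts of a real-rooted polynomial are
real. -/
lemma shifted_sum_ne_zero {z : ℂ} {c : ℝ} (hc : c ≠ 0) (hz : z.im ≠ 0) {s : Multiset ℝ}
    (hs : s ≠ 0) {ω ω' : ℂ} (hω : ‖ω‖ = ‖ω'‖) (h0 : ω ≠ 0) :
    ω * (s.map fun r : ℝ ↦ z + I * c - (r : ℂ)).prod +
      ω' * (s.map fun r : ℝ ↦ z - I * c - (r : ℂ)).prod ≠ 0 := fun h ↦ by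
  have h1 := congrArg norm (eq_neg_of_add_eq_zero_left h)
  rw [norm_neg, norm_mul, norm_mul, ← hω] at h1
  have h2 := mul_left_cancel₀ (norm_ne_zero_iff.2 h0) h1
  rcases (mul_ne_zero hc hz).lt_or_gt with h3 | h3
  · have := norm_multiset_prod_sub_lt (z := z) (c := -c) (by linarith) hs
    simp only [ofReal_neg, mul_neg, sub_neg_eq_add, ← sub_eq_add_neg] at this
    exact this.ne h2
  · exact (norm_multiset_prod_sub_lt h3 hs).ne' h2

/-- A weighted sum of two opposite imaginary shifts of a real-rooted polynomial has only real
zeros. -/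
lemma exists_roots_shifted_sum {c : ℝ} (hc : c ≠ 0) (s : Multiset ℝ) {ω ω' : ℂ}
    (hω : ‖ω‖ = ‖ω'‖) (h0 : ω ≠ 0) :
    ∃ (C : ℂ) (R : Multiset ℝ), ∀ z : ℂ,
      ω * (s.map fun r : ℝ ↦ z + I * c - (r : ℂ)).prod +
        ω' * (s.map fun r : ℝ ↦ z - I * c - (r : ℂ)).prod =
      C * (R.map fun r : ℝ ↦ z - (r : ℂ)).prod := by
  rcases eq_or_ne s 0 with rfl | hs
  · exact ⟨ω + ω', 0, by simp⟩
  let p : Polynomial ℂ := .C ω * (s.map fun r : ℝ ↦ .X + .C (I * c) - .C (r : ℂ)).prod +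
    .C ω' * (s.map fun r : ℝ ↦ .X - .C (I * c) - .C (r : ℂ)).prod
  have hp : ∀ z, p.eval z = ω * (s.map fun r : ℝ ↦ z + I * c - (r : ℂ)).prod +
      ω' * (s.map fun r : ℝ ↦ z - I * c - (r : ℂ)).prod := fun z ↦ by
    simp [p, Polynomial.eval_multiset_prod, Multiset.map_map]
  have hreal : ∀ z ∈ p.roots, ((z.re : ℝ) : ℂ) = z := fun z hz ↦ by
    have h1 := (Polynomial.mem_roots'.1 hz).2
    rw [Polynomial.IsRoot, hp] at h1
    have h2 : z.im = 0 := by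
      by_contra him
      exact shifted_sum_ne_zero hc him hs hω h0 h1
    exact Complex.ext rfl h2.symm
  refine ⟨p.leadingCoeff, p.roots.map re, fun z ↦ ?_⟩
  rw [← hp, (IsAlgClosed.splits p).eval_eq_prod_roots, Multiset.map_map]
  congr 2
  exact Multiset.map_congr rfl fun r hr ↦ by rw [Function.comp_apply, hreal r hr]

/-- An entire function that is not identically zero is nonzero at some real point. -/
lemma exists_ofReal_ne_zero {F : ℂ → ℂ} (hF : Differentiable ℂ F) {z₀ : ℂ} (hz₀ : F z₀ ≠ 0) :
    ∃ t : ℝ, F t ≠ 0 := by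
  by_contra! h
  have hlim : Tendsto (fun t : ℝ ↦ (t : ℂ)) (𝓝[≠] 0) (𝓝[≠] 0) :=
    tendsto_nhdsWithin_iff.2 ⟨(continuous_ofReal.tendsto' 0 0 ofReal_zero).mono_left
      nhdsWithin_le_nhds, eventually_mem_nhdsWithin.mono fun t ht ↦ by simpa using ht⟩
  have hfreq : ∃ᶠ z in 𝓝[≠] (0 : ℂ), F z = (fun _ ↦ 0) z :=
    hlim.frequently (Eventually.frequently (.of_forall h))
  exact hz₀ ((hF.differentiableOn.analyticOnNhd isOpen_univ).eqOn_of_preconnected_of_frequently_eq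
    analyticOnNhd_const isPreconnected_univ (Set.mem_univ 0) hfreq (Set.mem_univ z₀))

/-- Pólya: for `f ∈ 𝓛-𝓟` and `c ∈ ℝ`, the function
`z ↦ f(z + ic) + f(z - ic)` belongs to `𝓛-𝓟` or vanishes identically. -/
theorem statement15 (f : ℂ → ℂ) (hf : LaguerrePolya f) (c : ℝ) :
    LaguerrePolya (fun z => f (z + Complex.I * c) + f (z - Complex.I * c)) ∨
      ∀ z : ℂ, f (z + Complex.I * c) + f (z - Complex.I * c) = 0 := by
  obtain ⟨K, b, a, n, x, hK, ha, hx, hf⟩ := hf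
  set w : ℕ → ℝ := fun k ↦ (x k)⁻¹
  replace hf : ∀ z, f z = K * z ^ n * exp (-a * z ^ 2 + b * z) *
      ∏' k, weierstrassOne (z * w k) := fun z ↦ by
    rw [hf]
    simp [weierstrassOne, w]
  refine or_iff_not_imp_right.2 fun hne ↦ ?_
  push Not at hne
  rcases eq_or_ne c 0 with rfl | hc
  · refine laguerrePolya_of_canonical_form (K := 2 * K) (b := b) (u := w) n
      (by simpa using hK) ha hx fun z ↦ ?_
    simp only [ofReal_zero, mul_zero, add_zero, sub_zero]
    rw [hf]
    push_cast
    ring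
  set F : ℂ → ℂ := fun z ↦ f (z + I * c) + f (z - I * c) with hFdef
  obtain ⟨t, ht⟩ : ∃ t : ℝ, F t ≠ 0 := by
    obtain ⟨z₀, hz₀⟩ := hne
    have hd := differentiable_of_canonical_form hx hf
    refine exists_ofReal_ne_zero (F := F) ?_ hz₀
    exact (hd.comp (differentiable_id.add_const _)).add (hd.comp (differentiable_id.sub_const _))
  obtain ⟨β, g, hg, hlim⟩ := exists_tendsto_of_canonical_form ha hx hf
  choose D s hs using hg
  have hω : ∀ N, ‖exp (I * (β N * c : ℝ))‖ = ‖exp (-(I * (β N * c : ℝ)))‖ := fun N ↦ by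
    rw [mul_comm, ← neg_mul, ← ofReal_neg, norm_exp_ofReal_mul_I, norm_exp_ofReal_mul_I]
  choose C R hR using fun N ↦ exists_roots_shifted_sum hc (s N) (hω N) (exp_ne_zero _)
  obtain ⟨a', β', v, ha', hv, h⟩ := exists_canonical_form_at_of_tendsto (F := F) (b := β)
    (C := fun N ↦ D N * C N) (s := R) (fun z ↦ by
      refine ((hlim (z + I * c)).add (hlim (z - I * c))).congr fun N ↦ ?_
      have e1 : (β N : ℂ) * (z + I * c) = β N * z + I * (β N * c : ℝ) := by push_cast; ring
      have e2 : (β N : ℂ) * (z - I * c) = β N * z + -(I * (β N * c : ℝ)) := by push_cast; ring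
      rw [hs, hs, e1, e2, exp_add, exp_add]
      linear_combination (D N : ℂ) * exp (β N * z) * hR N z) ht
  have hreal : F t = ((F t).re : ℝ) := by
    refine (conj_eq_iff_re.1 ?_).symm
    simp only [hFdef, map_add]
    rw [← conj_of_canonical_form hx hf, ← conj_of_canonical_form hx hf, add_comm]
    simp [sub_eq_add_neg]
  rw [hreal] at h
  exact laguerrePolya_of_canonical_form_at ha' hv ⟨t, ht⟩ h
end
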